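/- Let X be a set and A a nonempty set of finitely supported functions X → ℕ. Then for every finitely supported ξ : X → ℕ and every z ∈ X, d_T(ξ, A)² ≤ d_T(ξ + δ_z, A)² ≤ d_T(ξ, A)² + 2. -/

import Mathlib

/-- The convex distance of a finite point configuration `ξ` (a finitely supported
function `X → ℕ`) to a set `A` of configurations:
`d_T(ξ, A) = sup_{‖u‖_ξ ≤ 1} inf_{ν ∈ A} Σ_{x ∈ supp ξ} u(x)·(ξ(x) − ν(x))₊`. -/
noncomputable def convexDist {X : Type*} (ξ : X →₀ ℕ) (A : Set (X →₀ ℕ)) : ℝ :=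
  sSup {r : ℝ | ∃ u : X → ℝ,
    (∑ x ∈ ξ.support, (ξ x : ℝ) * u x ^ 2) ≤ 1 ∧
    r = sInf {s : ℝ | ∃ ν ∈ A,
      s = ∑ x ∈ ξ.support, u x * max ((ξ x : ℝ) - (ν x : ℝ)) 0}}

/-- The sum `Σ_{x ∈ supp ξ} u(x)·(ξ(x) − ν(x))₊`. -/
noncomputable def weightedExcess {X : Type*} (ξ ν : X →₀ ℕ) (u : X → ℝ) : ℝ :=
  ∑ x ∈ ξ.support, u x * max ((ξ x : ℝ) - (ν x : ℝ)) 0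

/-- The infimum of the weighted excess of `ξ` over the configurations in `A`. -/
noncomputable def infExcess {X : Type*} (ξ : X →₀ ℕ) (A : Set (X →₀ ℕ)) (u : X → ℝ) : ℝ :=
  sInf {s : ℝ | ∃ ν ∈ A, s = weightedExcess ξ ν u}

/-- The squared norm `Σ_{x ∈ supp ξ} ξ(x)·u(x)²`. -/
noncomputable def weightSq {X : Type*} (ξ : X →₀ ℕ) (u : X → ℝ) : ℝ :=
  ∑ x ∈ ξ.support, (ξ x : ℝ) * u x ^ 2

section

variable {X : Type*} {A : Set (X →₀ ℕ)}

theorem posPart_natCast_sub_le (m k : ℕ) : max ((m : ℝ) - (k : ℝ)) 0 ≤ m :=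
  max_le (sub_le_self _ k.cast_nonneg) m.cast_nonneg

theorem abs_weightedExcess_le (ξ ν : X →₀ ℕ) (u : X → ℝ) :
    |weightedExcess ξ ν u| ≤ ∑ x ∈ ξ.support, |u x| * (ξ x : ℝ) := by
  refine (Finset.abs_sum_le_sum_abs _ _).trans (Finset.sum_le_sum fun x _ => ?_)
  rw [abs_mul, abs_of_nonneg (le_max_right ((ξ x : ℝ) - ν x) 0)]
  exact mul_le_mul_of_nonneg_left (posPart_natCast_sub_le _ _) (abs_nonneg _)

theorem infExcess_le (ξ : X →₀ ℕ) (u : X → ℝ) {ν : X →₀ ℕ} (hν : ν ∈ A) :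
    infExcess ξ A u ≤ weightedExcess ξ ν u := by
  refine csInf_le ⟨-∑ x ∈ ξ.support, |u x| * (ξ x : ℝ), ?_⟩ ⟨ν, hν, rfl⟩
  rintro _ ⟨μ, -, rfl⟩
  exact (abs_le.mp (abs_weightedExcess_le ξ μ u)).1

theorem le_infExcess (hA : A.Nonempty) {ξ : X →₀ ℕ} {u : X → ℝ} {b : ℝ}
    (h : ∀ ν ∈ A, b ≤ weightedExcess ξ ν u) : b ≤ infExcess ξ A u := by
  refine le_csInf ⟨_, _, hA.choose_spec, rfl⟩ ?_
  rintro _ ⟨ν, hν, rfl⟩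
  exact h ν hν

theorem infExcess_le_convexDist (hA : A.Nonempty) {ξ : X →₀ ℕ} {u : X → ℝ}
    (hu : weightSq ξ u ≤ 1) : infExcess ξ A u ≤ convexDist ξ A := by
  refine le_csSup ⟨1 + ∑ x ∈ ξ.support, (ξ x : ℝ), ?_⟩ ⟨u, hu, rfl⟩
  rintro _ ⟨v, hv, rfl⟩
  obtain ⟨ν, hν⟩ := hA
  have hle : ∑ x ∈ ξ.support, |v x| * (ξ x : ℝ) ≤
      ∑ x ∈ ξ.support, ((ξ x : ℝ) * v x ^ 2 + ξ x) := by
    refine Finset.sum_le_sum fun x _ => ?_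
    have h : |v x| ≤ v x ^ 2 + 1 := by
      nlinarith [sq_abs (v x), sq_nonneg (|v x| - 1), abs_nonneg (v x)]
    nlinarith [mul_le_mul_of_nonneg_right h (Nat.cast_nonneg (α := ℝ) (ξ x))]
  rw [Finset.sum_add_distrib] at hle
  calc infExcess ξ A v ≤ weightedExcess ξ ν v := infExcess_le ξ v hν
    _ ≤ ∑ x ∈ ξ.support, |v x| * (ξ x : ℝ) :=
        (le_abs_self _).trans (abs_weightedExcess_le ξ ν v)
    _ ≤ 1 + ∑ x ∈ ξ.support, (ξ x : ℝ) := by linarith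

theorem convexDist_le {ξ : X →₀ ℕ} {b : ℝ}
    (h : ∀ u, weightSq ξ u ≤ 1 → infExcess ξ A u ≤ b) : convexDist ξ A ≤ b := by
  refine csSup_le ⟨_, 0, by simp, rfl⟩ ?_
  rintro _ ⟨u, hu, rfl⟩
  exact h u hu

theorem convexDist_nonneg (hA : A.Nonempty) (ξ : X →₀ ℕ) : 0 ≤ convexDist ξ A := by
  have h0 : 0 ≤ infExcess ξ A 0 := le_infExcess hA fun ν _ => by simp [weightedExcess]
  exact h0.trans (infExcess_le_convexDist hA (by simp [weightSq]))

theorem weightSq_smul (ξ : X →₀ ℕ) (c : ℝ) (u : X → ℝ) :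
    weightSq ξ (c • u) = c ^ 2 * weightSq ξ u := by
  simp only [weightSq, Finset.mul_sum, Pi.smul_apply, smul_eq_mul]
  exact Finset.sum_congr rfl fun x _ => by ring

theorem weightedExcess_smul (ξ ν : X →₀ ℕ) (c : ℝ) (u : X → ℝ) :
    weightedExcess ξ ν (c • u) = c * weightedExcess ξ ν u := by
  simp only [weightedExcess, Finset.mul_sum, Pi.smul_apply, smul_eq_mul, mul_assoc]

theorem infExcess_le_mul_convexDist (hA : A.Nonempty) {ξ : X →₀ ℕ} {u : X → ℝ} {s : ℝ}
    (hs : 0 ≤ s) (hu : weightSq ξ u ≤ s ^ 2) : infExcess ξ A u ≤ s * convexDist ξ A := by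
  rcases hs.eq_or_lt with rfl | hs
  · obtain ⟨ν, hν⟩ := hA
    have hnonneg : ∀ x ∈ ξ.support, 0 ≤ (ξ x : ℝ) * u x ^ 2 := fun x _ => by positivity
    have hsum : weightSq ξ u = 0 :=
      le_antisymm (by simpa using hu) (Finset.sum_nonneg hnonneg)
    have hzero := (Finset.sum_eq_zero_iff_of_nonneg hnonneg).mp hsum
    refine (infExcess_le ξ u hν).trans (le_of_eq ?_)
    rw [zero_mul]
    refine Finset.sum_eq_zero fun x hx => ?_
    have hξ : (ξ x : ℝ) ≠ 0 := Nat.cast_ne_zero.mpr (Finsupp.mem_support_iff.mp hx)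
    have hux : u x = 0 := by simpa [hξ] using hzero x hx
    simp [hux]
  · have hscaled : weightSq ξ (s⁻¹ • u) ≤ 1 := by
      rw [weightSq_smul, inv_pow, inv_mul_le_iff₀ (by positivity)]
      simpa using hu
    have hle : s⁻¹ * infExcess ξ A u ≤ infExcess ξ A (s⁻¹ • u) := by
      refine le_infExcess hA fun ν hν => ?_
      rw [weightedExcess_smul]
      exact mul_le_mul_of_nonneg_left (infExcess_le ξ u hν) (by positivity)
    exact (inv_mul_le_iff₀ hs).mp (hle.trans (infExcess_le_convexDist hA hscaled))

theorem weightSq_eq_add_erase (ξ : X →₀ ℕ) (z : X) (u : X → ℝ) :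
    weightSq ξ u = ξ z * u z ^ 2 + weightSq (ξ.erase z) u := by
  classical
  have h := Finsupp.add_sum_erase' ξ z (fun x n => (n : ℝ) * u x ^ 2) (by simp)
  exact h.symm

theorem weightedExcess_eq_add_erase (ξ ν : X →₀ ℕ) (z : X) (u : X → ℝ) :
    weightedExcess ξ ν u =
      u z * max ((ξ z : ℝ) - ν z) 0 + weightedExcess (ξ.erase z) ν u := by
  classical
  have h := Finsupp.add_sum_erase' ξ z (fun x n => u x * max ((n : ℝ) - ν x) 0) (by simp)
  exact h.symm

theorem erase_add_single (ξ : X →₀ ℕ) (z : X) (n : ℕ) :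
    (ξ + Finsupp.single z n).erase z = ξ.erase z := by
  simp [Finsupp.erase_add]

theorem natCast_add_single_one_apply (ξ : X →₀ ℕ) (z : X) :
    (((ξ + Finsupp.single z 1 : X →₀ ℕ) z : ℕ) : ℝ) = ξ z + 1 := by
  simp

theorem weightSq_erase_update [DecidableEq X] (ξ : X →₀ ℕ) (z : X) (u : X → ℝ) (t : ℝ) :
    weightSq (ξ.erase z) (Function.update u z t) = weightSq (ξ.erase z) u := by
  refine Finset.sum_congr rfl fun x hx => ?_
  have hxz : x ≠ z := by rintro rfl; simp at hx
  rw [Function.update_of_ne hxz]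

theorem weightedExcess_erase_update [DecidableEq X] (ξ ν : X →₀ ℕ) (z : X) (u : X → ℝ)
    (t : ℝ) :
    weightedExcess (ξ.erase z) ν (Function.update u z t) = weightedExcess (ξ.erase z) ν u := by
  refine Finset.sum_congr rfl fun x hx => ?_
  have hxz : x ≠ z := by rintro rfl; simp at hx
  rw [Function.update_of_ne hxz]

theorem posPart_natCast_add_one_sub_le (m k : ℕ) :
    max ((m : ℝ) + 1 - k) 0 ≤ max ((m : ℝ) - k) 0 + 1 :=
  max_le (by linarith [le_max_left ((m : ℝ) - k) 0]) (by linarith [le_max_right ((m : ℝ) - k) 0])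

theorem posPart_natCast_sub_mul_le (m k : ℕ) :
    ((m : ℝ) + 1) * max ((m : ℝ) - k) 0 ≤ m * max ((m : ℝ) + 1 - k) 0 := by
  have hm : (0 : ℝ) ≤ m := m.cast_nonneg
  have hk : (0 : ℝ) ≤ k := k.cast_nonneg
  rcases le_total ((m : ℝ) - k) 0 with h | h
  · rw [max_eq_right h, mul_zero]
    exact mul_nonneg hm (le_max_right _ _)
  · rw [max_eq_left h, max_eq_left (by linarith)]
    nlinarith

theorem convexDist_le_convexDist_add_single (hA : A.Nonempty) (ξ : X →₀ ℕ) (z : X) :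
    convexDist ξ A ≤ convexDist (ξ + Finsupp.single z 1) A := by
  classical
  refine convexDist_le fun u hu => ?_
  set t : ℝ := max (u z) 0 * (ξ z / (ξ z + 1)) with ht
  have hn : (0 : ℝ) ≤ ξ z := (ξ z).cast_nonneg
  have hp : 0 ≤ max (u z) 0 := le_max_right _ _
  have hnorm : weightSq (ξ + Finsupp.single z 1) (Function.update u z t) ≤ 1 := by
    rw [weightSq_eq_add_erase _ z] at hu ⊢
    rw [erase_add_single, weightSq_erase_update, Function.update_self]
    refine le_trans (add_le_add_left ?_ _) hu
    have hsq : max (u z) 0 ^ 2 ≤ u z ^ 2 := by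
      rcases le_total (u z) 0 with h | h
      · rw [max_eq_right h]; nlinarith [sq_nonneg (u z)]
      · rw [max_eq_left h]
    have heq : ((ξ z : ℝ) + 1) * t ^ 2 =
        ξ z * max (u z) 0 ^ 2 * (ξ z / (ξ z + 1)) := by
      rw [ht]; field_simp
    have hfrac : (ξ z : ℝ) / (ξ z + 1) ≤ 1 := (div_le_one (by positivity)).mpr (by linarith)
    rw [natCast_add_single_one_apply, heq]
    exact (mul_le_of_le_one_right (by positivity) hfrac).trans
      (mul_le_mul_of_nonneg_left hsq hn)
  refine le_trans (le_infExcess hA fun ν hν => ?_) (infExcess_le_convexDist hA hnorm)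
  refine (infExcess_le ξ u hν).trans ?_
  rw [weightedExcess_eq_add_erase _ _ z, weightedExcess_eq_add_erase (ξ + _) _ z,
    erase_add_single, weightedExcess_erase_update, Function.update_self]
  refine add_le_add_left ?_ _
  have hfrac : max ((ξ z : ℝ) - ν z) 0 ≤ ξ z / (ξ z + 1) * max ((ξ z : ℝ) + 1 - ν z) 0 := by
    rw [div_mul_eq_mul_div, le_div_iff₀ (by positivity), mul_comm]
    exact posPart_natCast_sub_mul_le _ _
  rw [natCast_add_single_one_apply, ht, mul_assoc]
  exact (mul_le_mul_of_nonneg_right (le_max_left _ _) (le_max_right _ _)).trans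
    (mul_le_mul_of_nonneg_left hfrac hp)

theorem convexDist_add_single_sq_le (hA : A.Nonempty) (ξ : X →₀ ℕ) (z : X) :
    convexDist (ξ + Finsupp.single z 1) A ^ 2 ≤ convexDist ξ A ^ 2 + 1 := by
  suffices h : convexDist (ξ + Finsupp.single z 1) A ≤ √(convexDist ξ A ^ 2 + 1) from
    (Real.le_sqrt (convexDist_nonneg hA _) (by positivity)).mp h
  refine convexDist_le fun u hu => ?_
  rw [weightSq_eq_add_erase _ z, erase_add_single, natCast_add_single_one_apply] at hu
  have hξ := weightSq_eq_add_erase ξ z u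
  have hξ_nonneg : 0 ≤ weightSq ξ u := Finset.sum_nonneg fun x _ => by positivity
  have hs : √(1 - u z ^ 2) ^ 2 = 1 - u z ^ 2 := Real.sq_sqrt (by nlinarith)
  have hinf : infExcess (ξ + Finsupp.single z 1) A u - |u z| ≤ infExcess ξ A u := by
    refine le_infExcess hA fun ν hν => ?_
    have hle := infExcess_le (ξ + Finsupp.single z 1) u hν
    rw [weightedExcess_eq_add_erase _ _ z, erase_add_single, natCast_add_single_one_apply] at hle
    rw [weightedExcess_eq_add_erase ξ ν z]
    have hterm : u z * (max ((ξ z : ℝ) + 1 - ν z) 0 - max ((ξ z : ℝ) - ν z) 0) ≤ |u z| := by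
      have hmono : max ((ξ z : ℝ) - ν z) 0 ≤ max ((ξ z : ℝ) + 1 - ν z) 0 :=
        max_le_max_right 0 (by linarith)
      refine (mul_le_mul_of_nonneg_right (le_abs_self _) (sub_nonneg.mpr hmono)).trans ?_
      exact mul_le_of_le_one_right (abs_nonneg _)
        (by linarith [posPart_natCast_add_one_sub_le (ξ z) (ν z)])
    linarith
  have hscale : infExcess ξ A u ≤ √(1 - u z ^ 2) * convexDist ξ A :=
    infExcess_le_mul_convexDist hA (Real.sqrt_nonneg _) (by linarith)
  calc infExcess (ξ + Finsupp.single z 1) A u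
      ≤ √(1 - u z ^ 2) * convexDist ξ A + |u z| := by linarith
    _ ≤ √(convexDist ξ A ^ 2 + 1) := Real.le_sqrt_of_sq_le (by
        nlinarith [sq_nonneg (√(1 - u z ^ 2) - |u z| * convexDist ξ A), sq_abs (u z)])

end

/-- Relation (8.2): `0 ≤ D_z(d_T(ξ,A)²) ≤ 2`, i.e.
`d_T(ξ,A)² ≤ d_T(ξ + δ_z, A)² ≤ d_T(ξ,A)² + 2`. -/
theorem convexDist_sq_add_one_bounds {X : Type*} (A : Set (X →₀ ℕ))
    (hA : A.Nonempty) (ξ : X →₀ ℕ) (z : X) :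
    convexDist ξ A ^ 2 ≤ convexDist (ξ + Finsupp.single z 1) A ^ 2 ∧
    convexDist (ξ + Finsupp.single z 1) A ^ 2 ≤ convexDist ξ A ^ 2 + 2 := by
  refine ⟨pow_le_pow_left₀ (convexDist_nonneg hA ξ)
    (convexDist_le_convexDist_add_single hA ξ z) 2, ?_⟩
  linarith [convexDist_add_single_sq_le hA ξ z]
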